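/- arXiv:2008.13103 — 2 statements merged into one kernel-verified Lean document; each statement's English description precedes it below -/
import Mathlib

section
/- Let $\nu \in \mathbb{Z}^r$ be nonzero and coprime. Then the intersection $T^1_\nu \cap T^{r-1}_{\nu^\perp}$ is a finite set of cardinality exactly $\|\nu\|^2 = \sum_{j=1}^r \nu_j^2$. (Corollary `cardinalityinters' of the paper.) -/
open scoped Real

/-- The character `χ_ν : T → S¹`, `χ_ν(t₁,…,t_r) = ∏ⱼ tⱼ^{νⱼ}`, on the torus
`T = (S¹)^r`. -/
noncomputable def torusChar {r : ℕ} (ν : Fin r → ℤ) : (Fin r → Circle) →* Circle where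
  toFun t := ∏ j, t j ^ ν j
  map_one' := by simp
  map_mul' a b := by simp [mul_zpow, Finset.prod_mul_distrib]

/-- The subgroup (as a set) `T^{r-1}_{ν^⊥} = {(e^{ix₁},…,e^{ix_r}) : x ∈ ℝ^r, ∑ xⱼνⱼ = 0}`
of the torus `T = (S¹)^r`. -/
def TperpSet {r : ℕ} (ν : Fin r → ℤ) : Set (Fin r → Circle) :=
  {t | ∃ x : Fin r → ℝ, (∀ j, t j = Circle.exp (x j)) ∧ ∑ j, x j * (ν j : ℝ) = 0}

/-- The subgroup (as a set) `T¹_ν = {(e^{iθν₁},…,e^{iθν_r}) : θ ∈ ℝ}` of the torus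
`T = (S¹)^r`. -/
def T1Set {r : ℕ} (ν : Fin r → ℤ) : Set (Fin r → Circle) :=
  {t | ∃ θ : ℝ, ∀ j, t j = Circle.exp (θ * (ν j : ℝ))}

/-- The point `e^{2πikν/N}` of the torus. -/
noncomputable def torusRootPoint {r : ℕ} (ν : Fin r → ℤ) (N k : ℤ) : Fin r → Circle :=
  fun j => Circle.exp (2 * π * k / N * ν j)

theorem torusRootPoint_emod {r : ℕ} (ν : Fin r → ℤ) {N : ℤ} (hN : N ≠ 0) (k : ℤ) :
    torusRootPoint ν N (k % N) = torusRootPoint ν N k := by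
  have hN' : (N : ℝ) ≠ 0 := mod_cast hN
  funext j
  refine Circle.exp_eq_exp.2 ⟨-(k / N * ν j), ?_⟩
  have h : (k : ℝ) = (k % N : ℤ) + N * (k / N : ℤ) := mod_cast (Int.emod_add_mul_ediv k N).symm
  rw [h]
  push_cast
  field_simp
  ring

theorem torusRootPoint_injOn {r : ℕ} {ν : Fin r → ℤ} (hcop : Finset.univ.gcd ν = 1) (N : ℤ) :
    Set.InjOn (torusRootPoint ν N) (Set.Ico 0 N) := by
  intro k hk l hl h
  obtain ⟨a, ha⟩ := Finset.univ.gcd_eq_sum_mul ν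
  rw [hcop] at ha
  have hN : (N : ℝ) ≠ 0 := mod_cast (hk.1.trans_lt hk.2).ne'
  choose m hm using fun j => Circle.exp_eq_exp.1 (congrFun h j)
  have hm' : ∀ j, (k - l) * ν j = N * m j := fun j => by
    have h₁ := hm j
    have hπ := Real.pi_ne_zero
    field_simp at h₁
    have h₂ : ((k : ℝ) - l) * ν j = N * m j := by linarith
    exact_mod_cast h₂
  have hdvd : N ∣ k - l := by
    refine ⟨∑ j, a j * m j, ?_⟩
    rw [← mul_one (k - l), ha, Finset.mul_sum, Finset.mul_sum]
    exact Finset.sum_congr rfl fun j _ => by linear_combination a j * hm' j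
  have hmod : l % N = k % N := (Int.modEq_iff_dvd.2 hdvd)
  rwa [Int.emod_eq_of_lt hl.1 hl.2, Int.emod_eq_of_lt hk.1 hk.2, eq_comm] at hmod

theorem T1Set_inter_TperpSet_eq {r : ℕ} {ν : Fin r → ℤ} (hν : ν ≠ 0)
    (hcop : Finset.univ.gcd ν = 1) :
    T1Set ν ∩ TperpSet ν =
      torusRootPoint ν (∑ j, ν j ^ 2) '' Set.Ico 0 (∑ j, ν j ^ 2) := by
  have hpos : 0 < ∑ j, ν j ^ 2 := by
    obtain ⟨i, hi⟩ := Function.ne_iff.1 hν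
    exact Finset.sum_pos' (fun j _ => sq_nonneg _) ⟨i, Finset.mem_univ i, sq_pos_of_ne_zero hi⟩
  obtain ⟨N, hN⟩ : ∃ N, N = ∑ j, ν j ^ 2 := ⟨_, rfl⟩
  rw [← hN] at hpos ⊢
  have hNR : (N : ℝ) = ∑ j, (ν j : ℝ) * ν j := by
    rw [hN]; push_cast; simp only [sq]
  have hN0 : (N : ℝ) ≠ 0 := mod_cast hpos.ne'
  ext t
  constructor
  · rintro ⟨⟨θ, hθ⟩, x, hx, hsum⟩
    choose m hm using fun j => Circle.exp_eq_exp.1 ((hθ j).symm.trans (hx j))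
    have hθN : θ * N = 2 * π * (∑ j, m j * ν j : ℤ) := by
      calc θ * N = ∑ j, x j * ν j + 2 * π * (∑ j, m j * ν j : ℤ) := by
            rw [hNR]
            push_cast
            rw [Finset.mul_sum, Finset.mul_sum, ← Finset.sum_add_distrib]
            exact Finset.sum_congr rfl fun j _ => by linear_combination (ν j : ℝ) * hm j
        _ = _ := by rw [hsum, zero_add]
    refine ⟨(∑ j, m j * ν j) % N, ⟨Int.emod_nonneg _ hpos.ne', Int.emod_lt_of_pos _ hpos⟩, ?_⟩
    rw [torusRootPoint_emod ν hpos.ne']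
    funext j
    rw [hθ j, torusRootPoint, ← hθN, mul_div_cancel_right₀ _ hN0]
  · rintro ⟨k, -, rfl⟩
    obtain ⟨a, ha⟩ := Finset.univ.gcd_eq_sum_mul ν
    have haR : ∑ j, (ν j : ℝ) * a j = 1 := mod_cast ha.symm.trans hcop
    refine ⟨⟨_, fun j => rfl⟩, fun j => 2 * π * k / N * ν j - 2 * π * k * a j, fun j =>
      Circle.exp_eq_exp.2 ⟨k * a j, by push_cast; ring⟩, ?_⟩
    calc ∑ j, (2 * π * k / N * ν j - 2 * π * k * a j) * (ν j : ℝ)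
        = 2 * π * k / N * ∑ j, (ν j : ℝ) * ν j - 2 * π * k * ∑ j, (ν j : ℝ) * a j := by
          rw [Finset.mul_sum, Finset.mul_sum, ← Finset.sum_sub_distrib]
          exact Finset.sum_congr rfl fun j _ => by ring
      _ = 0 := by rw [← hNR, haR, div_mul_cancel₀ _ hN0, mul_one, sub_self]

/-- Corollary `cardinalityinters`: for `ν ∈ ℤ^r` nonzero and coprime, the intersection
`T¹_ν ∩ T^{r-1}_{ν^⊥}` is finite of cardinality `‖ν‖² = ∑ⱼ νⱼ²`. -/
theorem cardinality_inters {r : ℕ} (hr : 1 ≤ r) (ν : Fin r → ℤ) (hν : ν ≠ 0)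
    (hcop : Finset.univ.gcd ν = 1) :
    (T1Set ν ∩ TperpSet ν).Finite ∧
    ((T1Set ν ∩ TperpSet ν).ncard : ℤ) = ∑ j, ν j ^ 2 := by
  rw [T1Set_inter_TperpSet_eq hν hcop]
  refine ⟨(Set.finite_Ico _ _).image _, ?_⟩
  rw [(torusRootPoint_injOn hcop _).ncard_image, ← Finset.coe_Ico,
    Set.ncard_coe_finset, Int.card_Ico, sub_zero,
    Int.toNat_of_nonneg (Finset.sum_nonneg fun j _ => sq_nonneg _)]
end

section
/- Let $\nu \in \mathbb{Z}^r$ be nonzero and coprime. Then $T^1_\nu \cap T^{r-1}_{\nu^\perp}$ equals the cyclic subgroup $\{(e^{2\pi i j \nu_1/\|\nu\|^2},\dots,e^{2\pi i j \nu_r/\|\nu\|^2}) : j \in \mathbb{Z}\}$ of $T$ generated by $e^{2\pi i \nu/\|\nu\|^2} = (e^{2\pi i \nu_1/\|\nu\|^2},\dots,e^{2\pi i \nu_r/\|\nu\|^2})$. (Explicit description of the intersection established in the proofs of Lemma `chinu'iso' and Corollary `cardinalityinters'.) -/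
open scoped Real

/-- For `ν ∈ ℤ^r` nonzero and coprime, `T¹_ν ∩ T^{r-1}_{ν^⊥}` equals the cyclic subgroup
of the torus generated by `e^{2πiν/‖ν‖²}`, i.e. the set of points
`(e^{2πij ν₁/‖ν‖²},…,e^{2πij ν_r/‖ν‖²})` for `j ∈ ℤ`. -/
theorem inters_eq_cyclic {r : ℕ} (hr : 1 ≤ r) (ν : Fin r → ℤ) (hν : ν ≠ 0)
    (hcop : Finset.univ.gcd ν = 1) :
    T1Set ν ∩ TperpSet ν =
      {t : Fin r → Circle | ∃ k : ℤ,
        ∀ j, t j = Circle.exp (2 * π * (k : ℝ) * (ν j : ℝ) / ∑ i, (ν i : ℝ) ^ 2)} := by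
  have hN : ∑ i, (ν i : ℝ) ^ 2 ≠ 0 := by
    obtain ⟨j, hj⟩ := Function.ne_iff.mp hν
    have hj' : (ν j : ℝ) ≠ 0 := by exact_mod_cast hj
    exact (Finset.sum_pos' (fun i _ => sq_nonneg _) ⟨j, Finset.mem_univ j, by positivity⟩).ne'
  ext t
  constructor
  · rintro ⟨⟨θ, hθ⟩, x, hx, hx0⟩
    have h : ∀ j, ∃ m : ℤ, θ * ν j = x j + m * (2 * π) := fun j =>
      Circle.exp_eq_exp.mp ((hθ j).symm.trans (hx j))
    choose m hm using h
    have key : θ * ∑ i, (ν i : ℝ) ^ 2 = 2 * π * ((∑ i, m i * ν i : ℤ) : ℝ) := by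
      calc θ * ∑ i, (ν i : ℝ) ^ 2 = ∑ i, (x i * ν i + 2 * π * (m i * ν i)) := by
            rw [Finset.mul_sum]
            exact Finset.sum_congr rfl fun i _ => by linear_combination (ν i : ℝ) * hm i
        _ = 2 * π * ((∑ i, m i * ν i : ℤ) : ℝ) := by
            rw [Finset.sum_add_distrib, hx0, zero_add, ← Finset.mul_sum]
            push_cast
            rfl
    refine ⟨∑ i, m i * ν i, fun j => ?_⟩
    rw [hθ j, ← key]
    congr 1
    field_simp
  · rintro ⟨k, hk⟩
    obtain ⟨a, ha⟩ := Finset.gcd_eq_sum_mul Finset.univ ν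
    rw [hcop] at ha
    have ha' : ∑ i, (ν i : ℝ) * a i = 1 := by exact_mod_cast ha.symm
    refine ⟨⟨2 * π * k / ∑ i, (ν i : ℝ) ^ 2, fun j => ?_⟩,
      fun j => 2 * π * k / (∑ i, (ν i : ℝ) ^ 2) * ν j - 2 * π * k * a j, fun j => ?_, ?_⟩
    · rw [hk j]
      congr 1
      ring
    · rw [hk j, Circle.exp_eq_exp]
      exact ⟨k * a j, by push_cast; ring⟩
    · calc ∑ j, (2 * π * k / (∑ i, (ν i : ℝ) ^ 2) * ν j - 2 * π * k * a j) * (ν j : ℝ)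
          = 2 * π * k / (∑ i, (ν i : ℝ) ^ 2) * (∑ j, (ν j : ℝ) ^ 2)
              - 2 * π * k * ∑ j, (ν j : ℝ) * a j := by
            rw [Finset.mul_sum, Finset.mul_sum, ← Finset.sum_sub_distrib]
            exact Finset.sum_congr rfl fun i _ => by ring
        _ = 0 := by rw [ha', div_mul_cancel₀ _ hN]; ring
end
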